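/- arXiv:1905.12718 — 3 statements merged into one kernel-verified Lean document; each statement's English description precedes it below -/
import Mathlib

section
/- Fix α ∈ (0,1), ρ ∈ 𝒞 and P ∈ 𝒫^ρ, and let Z be a random variable with law P. Then (i) the map θ ↦ O^ρ(θ) = E[ρ_α(Z−θ) − ρ_α(Z)] is well-defined for every θ ∈ ℝ (the integrand is P-integrable), and it is left-differentiable and right-differentiable at every point of ℝ, hence continuous on ℝ; (ii) the corresponding one-sided derivatives satisfy O^ρ′_−(θ) ≤ O^ρ′_+(θ) at every θ ∈ ℝ. -/
open MeasureTheory Set Filter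

noncomputable section

/-- The class `𝒞` of loss functions: convex, nonnegative, even, vanishing only at `0`. -/
def LossClass (ρ : ℝ → ℝ) : Prop :=
  ConvexOn ℝ Set.univ ρ ∧ (∀ t, 0 ≤ ρ t) ∧ (∀ t, ρ (-t) = ρ t) ∧ (∀ t, ρ t = 0 ↔ t = 0)

/-- `ψ` is the left-derivative of `ρ`. -/
def IsLeftDeriv (ρ ψ : ℝ → ℝ) : Prop :=
  ∀ x : ℝ, HasDerivWithinAt ρ (ψ x) (Set.Iio x) x

/-- The asymmetric loss `ρ_α(t) = ((1−α)·𝟙[t<0] + α·𝟙[t>0])·ρ(t)`. -/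
def rhoA (ρ : ℝ → ℝ) (α t : ℝ) : ℝ :=
  ((1 - α) * (if t < 0 then 1 else 0) + α * (if 0 < t then 1 else 0)) * ρ t

/-- The objective function `O^ρ(θ) = E[ρ_α(Z−θ) − ρ_α(Z)]`. -/
def Obj (ρ : ℝ → ℝ) (α : ℝ) (P : Measure ℝ) (θ : ℝ) : ℝ :=
  ∫ z, (rhoA ρ α (z - θ) - rhoA ρ α z) ∂P

/-- `G^ρ(θ) = E[|ψ₋(Z−θ)|·𝟙[Z ≤ θ]] / E[|ψ₋(Z−θ)|]`. -/
def Gfun (ψ : ℝ → ℝ) (P : Measure ℝ) (θ : ℝ) : ℝ :=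
  (∫ z, |ψ (z - θ)| * (if z ≤ θ then 1 else 0) ∂P) / ∫ z, |ψ (z - θ)| ∂P

/-- The order-`α` M-quantile `θ^ρ_α(P) = inf{θ : G^ρ(θ) ≥ α}`. -/
def MQuant (ψ : ℝ → ℝ) (P : Measure ℝ) (α : ℝ) : ℝ :=
  sInf {θ : ℝ | α ≤ Gfun ψ P θ}

theorem ConvexOn.sub_le_leftDeriv_mul {f : ℝ → ℝ} {d y : ℝ} (hf : ConvexOn ℝ Set.univ f)
    (hd : HasDerivWithinAt f d (Set.Iio y) y) (x : ℝ) : f y - f x ≤ d * (y - x) := by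
  rcases lt_trichotomy x y with h | rfl | h
  · have := hf.slope_le_of_hasDerivWithinAt_Iio (mem_univ x) (mem_univ y) h hd
    rwa [slope_def_field, div_le_iff₀ (sub_pos.2 h)] at this
  · simp
  · have hy : y ∈ interior (Set.univ : Set ℝ) := by simp
    have h1 := hf.leftDeriv_le_rightDeriv_of_mem_interior hy
    have h2 := hf.rightDeriv_le_slope_of_mem_interior hy (mem_univ x) h
    rw [hd.derivWithin (uniqueDiffWithinAt_Iio y)] at h1
    have h3 := h1.trans h2
    rw [slope_def_field, le_div_iff₀ (sub_pos.2 h)] at h3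
    linarith

namespace LossClass

variable {ρ : ℝ → ℝ}

theorem apply_zero (hρ : LossClass ρ) : ρ 0 = 0 := (hρ.2.2.2 0).2 rfl

theorem monotoneOn_Ici (hρ : LossClass ρ) : MonotoneOn ρ (Set.Ici 0) := by
  intro x hx y _ hxy
  have h := hρ.1.le_max_of_mem_Icc (mem_univ 0) (mem_univ y) ⟨hx, hxy⟩
  rwa [hρ.apply_zero, max_eq_right (hρ.2.1 y)] at h

theorem rhoA_eq (hρ : LossClass ρ) (α t : ℝ) :
    rhoA ρ α t = (1 - α) * ρ (min t 0) + α * ρ (max t 0) := by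
  rcases lt_trichotomy t 0 with h | rfl | h
  · simp [rhoA, h, h.le, h.not_gt, hρ.apply_zero]
  · simp [rhoA, hρ.apply_zero]
  · simp [rhoA, h, h.le, h.not_gt, hρ.apply_zero]

theorem convexOn_comp_max (hρ : LossClass ρ) :
    ConvexOn ℝ Set.univ fun t => ρ (max t 0) := by
  refine ⟨convex_univ, fun x _ y _ a b ha hb hab => ?_⟩
  have hx := mul_nonneg ha (le_max_right x 0)
  have hy := mul_nonneg hb (le_max_right y 0)
  have h : max (a • x + b • y) 0 ≤ a • max x 0 + b • max y 0 := by
    simp only [smul_eq_mul]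
    refine max_le (add_le_add ?_ ?_) (add_nonneg hx hy)
    · exact mul_le_mul_of_nonneg_left (le_max_left x 0) ha
    · exact mul_le_mul_of_nonneg_left (le_max_left y 0) hb
  exact (hρ.monotoneOn_Ici (mem_Ici.2 (le_max_right _ 0)) (add_nonneg hx hy) h).trans
    (hρ.1.2 (mem_univ _) (mem_univ _) ha hb hab)

theorem convexOn_comp_min (hρ : LossClass ρ) :
    ConvexOn ℝ Set.univ fun t => ρ (min t 0) := by
  have h : (fun t => ρ (min t 0)) = fun t => ρ (max (-t) 0) := by
    funext t
    rw [← hρ.2.2.1 (min t 0), ← max_neg_neg, neg_zero]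
  rw [h]
  refine ⟨convex_univ, fun x _ y _ a b ha hb hab => ?_⟩
  have := hρ.convexOn_comp_max.2 (mem_univ (-x)) (mem_univ (-y)) ha hb hab
  simpa only [smul_neg, ← neg_add] using this

theorem convexOn_rhoA (hρ : LossClass ρ) {α : ℝ} (hα : α ∈ Set.Icc (0 : ℝ) 1) :
    ConvexOn ℝ Set.univ (rhoA ρ α) := by
  rw [show rhoA ρ α = fun t => (1 - α) * ρ (min t 0) + α * ρ (max t 0) from
    funext (hρ.rhoA_eq α)]
  exact (hρ.convexOn_comp_min.smul (sub_nonneg.2 hα.2)).add (hρ.convexOn_comp_max.smul hα.1)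

variable {ψ : ℝ → ℝ}

theorem sub_le_abs_leftDeriv_mul (hρ : LossClass ρ) (hψ : IsLeftDeriv ρ ψ) {x y u v : ℝ}
    (hv : v = y ∨ v = 0) (huv : |v - u| ≤ |y - x|) : ρ v - ρ u ≤ |ψ y| * |y - x| := by
  rcases hv with rfl | rfl
  · calc ρ v - ρ u ≤ ψ v * (v - u) := hρ.1.sub_le_leftDeriv_mul (hψ v) u
      _ ≤ |ψ v| * |v - u| := (le_abs_self _).trans_eq (abs_mul _ _)
      _ ≤ |ψ v| * |v - x| := mul_le_mul_of_nonneg_left huv (abs_nonneg _)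
  · have h1 := hρ.2.1 u
    have h2 : 0 ≤ |ψ y| * |y - x| := by positivity
    rw [hρ.apply_zero]
    linarith

theorem rhoA_sub_le (hρ : LossClass ρ) (hψ : IsLeftDeriv ρ ψ) {α : ℝ}
    (hα : α ∈ Set.Icc (0 : ℝ) 1) (x y : ℝ) :
    rhoA ρ α y - rhoA ρ α x ≤ |ψ y| * |y - x| := by
  have h1 := hρ.sub_le_abs_leftDeriv_mul hψ (min_choice y 0)
    (by simpa using abs_min_sub_min_le_max y 0 x 0)
  have h2 := hρ.sub_le_abs_leftDeriv_mul hψ (max_choice y 0)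
    (abs_max_sub_max_le_abs y x 0)
  rw [hρ.rhoA_eq, hρ.rhoA_eq]
  linarith [mul_le_mul_of_nonneg_left h1 (sub_nonneg.2 hα.2), mul_le_mul_of_nonneg_left h2 hα.1]

theorem abs_rhoA_sub_le (hρ : LossClass ρ) (hψ : IsLeftDeriv ρ ψ) {α : ℝ}
    (hα : α ∈ Set.Icc (0 : ℝ) 1) (x y : ℝ) :
    |rhoA ρ α y - rhoA ρ α x| ≤ (|ψ y| + |ψ x|) * |y - x| := by
  have h1 := hρ.rhoA_sub_le hψ hα x y
  have h2 := hρ.rhoA_sub_le hψ hα y x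
  rw [abs_sub_comm x y] at h2
  have h3 : 0 ≤ |ψ y| * |y - x| := by positivity
  have h4 : 0 ≤ |ψ x| * |y - x| := by positivity
  rw [abs_le]
  constructor <;> linarith

theorem integrable_rhoA_sub (hρ : LossClass ρ) (hψ : IsLeftDeriv ρ ψ) {α : ℝ}
    (hα : α ∈ Set.Icc (0 : ℝ) 1) {P : Measure ℝ}
    (hP : ∀ θ : ℝ, Integrable (fun z => |ψ (z - θ)|) P) (θ : ℝ) :
    Integrable (fun z => rhoA ρ α (z - θ) - rhoA ρ α z) P := by
  have hc : Continuous (rhoA ρ α) :=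
    continuousOn_univ.1 ((hρ.convexOn_rhoA hα).continuousOn isOpen_univ)
  have h0 := hP 0
  simp only [sub_zero] at h0
  refine (((hP θ).add h0).mul_const |θ|).mono' (by fun_prop) (.of_forall fun z => ?_)
  simpa using hρ.abs_rhoA_sub_le hψ hα z (z - θ)

theorem convexOn_Obj (hρ : LossClass ρ) {α : ℝ} (hα : α ∈ Set.Icc (0 : ℝ) 1) {P : Measure ℝ}
    (hint : ∀ θ : ℝ, Integrable (fun z => rhoA ρ α (z - θ) - rhoA ρ α z) P) :
    ConvexOn ℝ Set.univ (Obj ρ α P) := by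
  refine ⟨convex_univ, fun x _ y _ a b ha hb hab => ?_⟩
  simp only [Obj, smul_eq_mul]
  rw [← integral_const_mul, ← integral_const_mul,
    ← integral_add ((hint x).const_mul a) ((hint y).const_mul b)]
  refine integral_mono (hint _) (((hint x).const_mul a).add ((hint y).const_mul b)) fun z => ?_
  have h := (hρ.convexOn_rhoA hα).2 (mem_univ (z - x)) (mem_univ (z - y)) ha hb hab
  have hb' : b = 1 - a := by linarith
  simp only [smul_eq_mul] at h
  rw [show a * (z - x) + b * (z - y) = z - (a * x + b * y) by subst hb'; ring] at h
  subst hb'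
  beta_reduce
  linarith

end LossClass

theorem stmt_0 (α : ℝ) (hα : α ∈ Set.Ioo (0 : ℝ) 1)
    (ρ ψ : ℝ → ℝ) (hρ : LossClass ρ) (hψ : IsLeftDeriv ρ ψ)
    (P : Measure ℝ) [IsProbabilityMeasure P]
    (hP1 : ∀ θ : ℝ, P {θ} < 1)
    (hP2 : ∀ θ : ℝ, Integrable (fun z => |ψ (z - θ)|) P) :
    (∀ θ : ℝ, Integrable (fun z => rhoA ρ α (z - θ) - rhoA ρ α z) P) ∧
    (∀ θ : ℝ,
      (∃ L : ℝ, HasDerivWithinAt (Obj ρ α P) L (Set.Iio θ) θ) ∧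
      (∃ L : ℝ, HasDerivWithinAt (Obj ρ α P) L (Set.Ioi θ) θ)) ∧
    Continuous (Obj ρ α P) ∧
    (∀ θ L R : ℝ, HasDerivWithinAt (Obj ρ α P) L (Set.Iio θ) θ →
      HasDerivWithinAt (Obj ρ α P) R (Set.Ioi θ) θ → L ≤ R) := by
  have hα' : α ∈ Set.Icc (0 : ℝ) 1 := Ioo_subset_Icc_self hα
  have hint := hρ.integrable_rhoA_sub hψ hα' hP2
  have hO := hρ.convexOn_Obj hα' hint
  have hmem : ∀ θ : ℝ, θ ∈ interior (Set.univ : Set ℝ) := by simp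
  refine ⟨hint, fun θ => ⟨⟨_, hO.hasDerivWithinAt_leftDeriv_of_mem_interior (hmem θ)⟩,
    ⟨_, hO.hasDerivWithinAt_rightDeriv_of_mem_interior (hmem θ)⟩⟩,
    continuousOn_univ.1 (hO.continuousOn isOpen_univ), fun θ L R hL hR => ?_⟩
  rw [← hL.derivWithin (uniqueDiffWithinAt_Iio θ), ← hR.derivWithin (uniqueDiffWithinAt_Ioi θ)]
  exact hO.leftDeriv_le_rightDeriv_of_mem_interior (hmem θ)
end
end

section
/- Fix ρ ∈ 𝒞 and P ∈ 𝒫^ρ, and let Z have law P. Then the function θ ↦ G^ρ(θ) = E[|ψ₋(Z−θ)|·𝟙[Z ≤ θ]] / E[|ψ₋(Z−θ)|] is a cumulative distribution function on ℝ: it is monotone non-decreasing, right-continuous, tends to 0 as θ → −∞, and tends to 1 as θ → +∞. -/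
open MeasureTheory Set Filter

noncomputable section

theorem abs_posPart_le_abs (t : ℝ) : |t⁺| ≤ |t| := by
  rw [abs_of_nonneg (posPart_nonneg t), ← posPart_add_negPart t]
  linarith [negPart_nonneg t]

theorem abs_negPart_le_abs (t : ℝ) : |t⁻| ≤ |t| := by
  rw [abs_of_nonneg (negPart_nonneg t), ← posPart_add_negPart t]
  linarith [posPart_nonneg t]

namespace IsLeftDeriv

variable {ρ ψ : ℝ → ℝ} {P : Measure ℝ}

theorem eq_derivWithin (hψ : IsLeftDeriv ρ ψ) (x : ℝ) : ψ x = derivWithin ρ (Iio x) x :=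
  ((hψ x).derivWithin (uniqueDiffWithinAt_Iio x)).symm

theorem le_slope (hρ : ConvexOn ℝ univ ρ) (hψ : IsLeftDeriv ρ ψ) {x y : ℝ} (hxy : x < y) :
    ψ x ≤ slope ρ x y := by
  rw [hψ.eq_derivWithin]
  exact (hρ.leftDeriv_le_rightDeriv_of_mem_interior (by simp)).trans
    (hρ.rightDeriv_le_slope_of_mem_interior (by simp) (mem_univ y) hxy)

theorem slope_le (hρ : ConvexOn ℝ univ ρ) (hψ : IsLeftDeriv ρ ψ) {x y : ℝ} (hxy : x < y) :
    slope ρ x y ≤ ψ y :=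
  hρ.slope_le_of_hasDerivWithinAt_Iio (mem_univ x) (mem_univ y) hxy (hψ y)

theorem monotone (hρ : ConvexOn ℝ univ ρ) (hψ : IsLeftDeriv ρ ψ) : Monotone ψ := by
  intro x y hxy
  rcases hxy.eq_or_lt with rfl | h
  · exact le_rfl
  · exact (hψ.le_slope hρ h).trans (hψ.slope_le hρ h)

theorem continuousWithinAt_Iic (hρ : ConvexOn ℝ univ ρ) (hψ : IsLeftDeriv ρ ψ) (x : ℝ) :
    ContinuousWithinAt ψ (Iic x) x := by
  refine tendsto_order.2 ⟨fun a ha => ?_, fun a ha => ?_⟩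
  · have hslope := (hasDerivWithinAt_iff_tendsto_slope' self_notMem_Iio).1 (hψ x)
    obtain ⟨w, haw, hwx⟩ :=
      ((hslope.eventually (lt_mem_nhds ha)).and self_mem_nhdsWithin).exists
    have hwx : w < x := hwx
    have hcont : ContinuousAt (fun y => slope ρ w y) x := by
      have : ContinuousAt ρ x := (hρ.continuousOn isOpen_univ).continuousAt univ_mem
      simp only [slope_def_field]
      exact (this.sub continuousAt_const).div (continuousAt_id.sub continuousAt_const)
        (sub_pos.2 hwx).ne'
    rw [slope_comm] at haw
    filter_upwards [nhdsWithin_le_nhds (hcont.eventually (lt_mem_nhds haw)),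
      nhdsWithin_le_nhds (lt_mem_nhds hwx)] with y hy hwy
    exact hy.trans_le (hψ.slope_le hρ hwy)
  · filter_upwards [self_mem_nhdsWithin] with y hy
    exact (hψ.monotone hρ hy).trans_lt ha

theorem neg_of_neg (hρ : LossClass ρ) (hψ : IsLeftDeriv ρ ψ) {x : ℝ} (hx : x < 0) : ψ x < 0 := by
  obtain ⟨hc, hn, -, h0⟩ := hρ
  have hpos : 0 < ρ x := (hn x).lt_of_ne fun h => hx.ne ((h0 x).1 h.symm)
  refine (hψ.le_slope hc hx).trans_lt ?_
  rw [slope_def_field, (h0 0).2 rfl]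
  exact div_neg_of_neg_of_pos (by linarith) (by linarith)

theorem pos_of_pos (hρ : LossClass ρ) (hψ : IsLeftDeriv ρ ψ) {x : ℝ} (hx : 0 < x) : 0 < ψ x := by
  obtain ⟨hc, hn, -, h0⟩ := hρ
  have hpos : 0 < ρ x := (hn x).lt_of_ne fun h => hx.ne' ((h0 x).1 h.symm)
  refine lt_of_lt_of_le ?_ (hψ.slope_le hc hx)
  rw [slope_def_field, (h0 0).2 rfl]
  exact div_pos (by linarith) (by linarith)

theorem nonpos_of_nonpos (hρ : LossClass ρ) (hψ : IsLeftDeriv ρ ψ) {x : ℝ} (hx : x ≤ 0) :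
    ψ x ≤ 0 := by
  refine (hψ.monotone hρ.1 hx).trans ?_
  have h := hψ.continuousWithinAt_Iic hρ.1 0
  refine le_of_tendsto (h.mono_left (nhdsWithin_mono 0 Iio_subset_Iic_self)) ?_
  filter_upwards [self_mem_nhdsWithin] with y hy
  exact (hψ.neg_of_neg hρ hy).le

theorem measurable_comp_sub (hρ : ConvexOn ℝ univ ρ) (hψ : IsLeftDeriv ρ ψ) (θ : ℝ) :
    Measurable fun z => ψ (z - θ) :=
  (hψ.monotone hρ).measurable.comp (measurable_id.sub_const θ)

theorem abs_comp_sub_le (hρ : ConvexOn ℝ univ ρ) (hψ : IsLeftDeriv ρ ψ) {a b θ : ℝ}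
    (ha : a ≤ θ) (hb : θ ≤ b) (z : ℝ) :
    |ψ (z - θ)| ≤ |ψ (z - a)| + |ψ (z - b)| := by
  have h1 : ψ (z - θ) ≤ ψ (z - a) := hψ.monotone hρ (by linarith)
  have h2 : ψ (z - b) ≤ ψ (z - θ) := hψ.monotone hρ (by linarith)
  refine (abs_le_max_abs_abs h2 h1).trans (max_le ?_ ?_)
  · linarith [abs_nonneg (ψ (z - a))]
  · linarith [abs_nonneg (ψ (z - b))]

theorem integrable_comp {g : ℝ → ℝ} (hg : Continuous g) (hle : ∀ t, |g t| ≤ |t|)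
    (hρ : ConvexOn ℝ univ ρ) (hψ : IsLeftDeriv ρ ψ) {θ : ℝ}
    (hP : Integrable (fun z => |ψ (z - θ)|) P) :
    Integrable (fun z => g (ψ (z - θ))) P :=
  hP.mono' (hg.measurable.comp (hψ.measurable_comp_sub hρ θ)).aestronglyMeasurable
    (Eventually.of_forall fun _ => hle _)

theorem continuousWithinAt_integral_comp {g : ℝ → ℝ} (hg : Continuous g) (hle : ∀ t, |g t| ≤ |t|)
    (hρ : ConvexOn ℝ univ ρ) (hψ : IsLeftDeriv ρ ψ)
    (hP : ∀ θ : ℝ, Integrable (fun z => |ψ (z - θ)|) P) (θ : ℝ) :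
    ContinuousWithinAt (fun θ => ∫ z, g (ψ (z - θ)) ∂P) (Ici θ) θ := by
  refine tendsto_integral_filter_of_dominated_convergence
    (fun z => |ψ (z - θ)| + |ψ (z - (θ + 1))|)
    (Eventually.of_forall fun t =>
      (hψ.integrable_comp hg hle hρ (hP t)).aestronglyMeasurable) ?_ ((hP θ).add (hP _)) ?_
  · filter_upwards [self_mem_nhdsWithin,
      nhdsWithin_le_nhds (gt_mem_nhds (lt_add_one θ))] with t ht ht1
    exact Eventually.of_forall fun z => (hle _).trans (hψ.abs_comp_sub_le hρ ht ht1.le z)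
  · refine Eventually.of_forall fun z => (hg.tendsto _).comp ?_
    refine (hψ.continuousWithinAt_Iic hρ (z - θ)).tendsto.comp
      (tendsto_nhdsWithin_iff.2 ⟨?_, ?_⟩)
    · exact ((continuous_const.sub continuous_id).tendsto θ).mono_left nhdsWithin_le_nhds
    · filter_upwards [self_mem_nhdsWithin] with t ht
      exact sub_le_sub_left ht z

theorem integrable_posPart (hρ : ConvexOn ℝ univ ρ) (hψ : IsLeftDeriv ρ ψ) {θ : ℝ}
    (hP : Integrable (fun z => |ψ (z - θ)|) P) : Integrable (fun z => (ψ (z - θ))⁺) P :=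
  hψ.integrable_comp continuous_posPart abs_posPart_le_abs hρ hP

theorem integrable_negPart (hρ : ConvexOn ℝ univ ρ) (hψ : IsLeftDeriv ρ ψ) {θ : ℝ}
    (hP : Integrable (fun z => |ψ (z - θ)|) P) : Integrable (fun z => (ψ (z - θ))⁻) P :=
  hψ.integrable_comp continuous_negPart abs_negPart_le_abs hρ hP

theorem antitone_integral_posPart (hρ : ConvexOn ℝ univ ρ) (hψ : IsLeftDeriv ρ ψ)
    (hP : ∀ θ : ℝ, Integrable (fun z => |ψ (z - θ)|) P) :
    Antitone fun θ => ∫ z, (ψ (z - θ))⁺ ∂P := fun a b hab =>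
  integral_mono (hψ.integrable_posPart hρ (hP b)) (hψ.integrable_posPart hρ (hP a)) fun z =>
    posPart_mono (hψ.monotone hρ (sub_le_sub_left hab z))

theorem monotone_integral_negPart (hρ : ConvexOn ℝ univ ρ) (hψ : IsLeftDeriv ρ ψ)
    (hP : ∀ θ : ℝ, Integrable (fun z => |ψ (z - θ)|) P) :
    Monotone fun θ => ∫ z, (ψ (z - θ))⁻ ∂P := fun a b hab =>
  integral_mono (hψ.integrable_negPart hρ (hP a)) (hψ.integrable_negPart hρ (hP b)) fun z =>
    negPart_anti (hψ.monotone hρ (sub_le_sub_left hab z))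

theorem tendsto_integral_posPart_atTop (hρ : LossClass ρ) (hψ : IsLeftDeriv ρ ψ)
    (hP : ∀ θ : ℝ, Integrable (fun z => |ψ (z - θ)|) P) :
    Tendsto (fun θ => ∫ z, (ψ (z - θ))⁺ ∂P) atTop (nhds 0) := by
  rw [← integral_zero ℝ ℝ (μ := P)]
  refine tendsto_integral_filter_of_dominated_convergence (fun z => (ψ (z - 0))⁺)
    (Eventually.of_forall fun t => (hψ.integrable_posPart hρ.1 (hP t)).aestronglyMeasurable) ?_
    (hψ.integrable_posPart hρ.1 (hP 0)) ?_
  · filter_upwards [eventually_ge_atTop 0] with t ht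
    refine Eventually.of_forall fun z => ?_
    rw [Real.norm_of_nonneg (posPart_nonneg _)]
    exact posPart_mono (hψ.monotone hρ.1 (sub_le_sub_left ht z))
  · refine Eventually.of_forall fun z => tendsto_const_nhds.congr' ?_
    filter_upwards [eventually_ge_atTop z] with t ht
    exact (posPart_eq_zero.2 (hψ.nonpos_of_nonpos hρ (sub_nonpos.2 ht))).symm

theorem tendsto_integral_negPart_atBot (hρ : LossClass ρ) (hψ : IsLeftDeriv ρ ψ)
    (hP : ∀ θ : ℝ, Integrable (fun z => |ψ (z - θ)|) P) :
    Tendsto (fun θ => ∫ z, (ψ (z - θ))⁻ ∂P) atBot (nhds 0) := by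
  rw [← integral_zero ℝ ℝ (μ := P)]
  refine tendsto_integral_filter_of_dominated_convergence (fun z => (ψ (z - 0))⁻)
    (Eventually.of_forall fun t => (hψ.integrable_negPart hρ.1 (hP t)).aestronglyMeasurable) ?_
    (hψ.integrable_negPart hρ.1 (hP 0)) ?_
  · filter_upwards [eventually_le_atBot 0] with t ht
    refine Eventually.of_forall fun z => ?_
    rw [Real.norm_of_nonneg (negPart_nonneg _)]
    exact negPart_anti (hψ.monotone hρ.1 (sub_le_sub_left ht z))
  · refine Eventually.of_forall fun z => tendsto_const_nhds.congr' ?_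
    filter_upwards [eventually_lt_atBot z] with t ht
    exact (negPart_eq_zero.2 (hψ.pos_of_pos hρ (sub_pos.2 ht)).le).symm

theorem integral_abs_eq (hρ : ConvexOn ℝ univ ρ) (hψ : IsLeftDeriv ρ ψ) {θ : ℝ}
    (hP : Integrable (fun z => |ψ (z - θ)|) P) :
    ∫ z, |ψ (z - θ)| ∂P = ∫ z, (ψ (z - θ))⁻ ∂P + ∫ z, (ψ (z - θ))⁺ ∂P := by
  rw [← integral_add (hψ.integrable_negPart hρ hP) (hψ.integrable_posPart hρ hP)]
  exact integral_congr_ae (Eventually.of_forall fun z => by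
    simp only [← posPart_add_negPart (ψ (z - θ)), add_comm])

theorem gfun_eq (hρ : LossClass ρ) (hψ : IsLeftDeriv ρ ψ) {θ : ℝ}
    (hP : Integrable (fun z => |ψ (z - θ)|) P) :
    Gfun ψ P θ =
      (∫ z, (ψ (z - θ))⁻ ∂P) / (∫ z, (ψ (z - θ))⁻ ∂P + ∫ z, (ψ (z - θ))⁺ ∂P) := by
  rw [Gfun, hψ.integral_abs_eq hρ.1 hP]
  congr 1
  refine integral_congr_ae (Eventually.of_forall fun z => ?_)
  dsimp only
  split_ifs with h
  · have := hψ.nonpos_of_nonpos hρ (sub_nonpos.2 h)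
    rw [mul_one, abs_of_nonpos this, negPart_of_nonpos this]
  · rw [mul_zero, negPart_eq_zero.2 (hψ.pos_of_pos hρ (sub_pos.2 (not_le.1 h))).le]

theorem integral_abs_pos [IsProbabilityMeasure P] (hρ : LossClass ρ) (hψ : IsLeftDeriv ρ ψ)
    {θ : ℝ} (hθ : P {θ} < 1) (hP : Integrable (fun z => |ψ (z - θ)|) P) :
    0 < ∫ z, |ψ (z - θ)| ∂P := by
  refine (integral_nonneg fun z => abs_nonneg _).lt_of_ne fun h => hθ.ne ?_
  have h0 := (integral_eq_zero_iff_of_nonneg (fun z => abs_nonneg _) hP).1 h.symm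
  refine (mem_ae_iff_prob_eq_one (measurableSet_singleton θ)).1 ?_
  filter_upwards [h0] with z hz
  have hz : ψ (z - θ) = 0 := abs_eq_zero.1 hz
  rcases lt_trichotomy z θ with h | h | h
  · exact absurd hz (hψ.neg_of_neg hρ (sub_neg.2 h)).ne
  · exact h
  · exact absurd hz (hψ.pos_of_pos hρ (sub_pos.2 h)).ne'

theorem exists_integral_negPart_pos [IsProbabilityMeasure P] (hρ : LossClass ρ)
    (hψ : IsLeftDeriv ρ ψ) (hP : ∀ θ : ℝ, Integrable (fun z => |ψ (z - θ)|) P) :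
    ∃ θ : ℝ, 0 < ∫ z, (ψ (z - θ))⁻ ∂P := by
  by_contra! hcon
  have hae : ∀ᵐ z ∂P, ∀ n : ℕ, (n : ℝ) ≤ z := by
    refine ae_all_iff.2 fun n => ?_
    have h0 := (integral_eq_zero_iff_of_nonneg (fun z => negPart_nonneg _)
      (hψ.integrable_negPart hρ.1 (hP n))).1
      ((hcon n).antisymm (integral_nonneg fun z => negPart_nonneg _))
    filter_upwards [h0] with z hz
    by_contra! h
    exact absurd (negPart_eq_zero.1 hz) (hψ.neg_of_neg hρ (sub_neg.2 h)).not_ge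
  obtain ⟨z, hz⟩ := hae.exists
  obtain ⟨n, hn⟩ := exists_nat_gt z
  exact absurd (hz n) hn.not_ge

theorem exists_integral_posPart_pos [IsProbabilityMeasure P] (hρ : LossClass ρ)
    (hψ : IsLeftDeriv ρ ψ) (hP : ∀ θ : ℝ, Integrable (fun z => |ψ (z - θ)|) P) :
    ∃ θ : ℝ, 0 < ∫ z, (ψ (z - θ))⁺ ∂P := by
  by_contra! hcon
  have hae : ∀ᵐ z ∂P, ∀ n : ℕ, z ≤ -(n : ℝ) := by
    refine ae_all_iff.2 fun n => ?_
    have h0 := (integral_eq_zero_iff_of_nonneg (fun z => posPart_nonneg _)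
      (hψ.integrable_posPart hρ.1 (hP (-n)))).1
      ((hcon (-n)).antisymm (integral_nonneg fun z => posPart_nonneg _))
    filter_upwards [h0] with z hz
    by_contra! h
    exact absurd (posPart_eq_zero.1 hz) (hψ.pos_of_pos hρ (sub_pos.2 h)).not_ge
  obtain ⟨z, hz⟩ := hae.exists
  obtain ⟨n, hn⟩ := exists_nat_gt (-z)
  linarith [hz n]

end IsLeftDeriv

/-- If `u ≥ 0`, `u → 0` and `v` is eventually at least some `c > 0`, then `u / (u + v) → 0`. -/
theorem tendsto_div_add_zero {l : Filter ℝ} {u v : ℝ → ℝ} {c : ℝ} (hc : 0 < c)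
    (hu0 : ∀ x, 0 ≤ u x) (hu : Tendsto u l (nhds 0)) (hv : ∀ᶠ x in l, c ≤ v x) :
    Tendsto (fun x => u x / (u x + v x)) l (nhds 0) := by
  have h : Tendsto (fun x => u x / c) l (nhds 0) := by simpa using hu.div_const c
  refine tendsto_of_tendsto_of_tendsto_of_le_of_le' tendsto_const_nhds h ?_ ?_
  · filter_upwards [hv] with x hx
    exact div_nonneg (hu0 x) (by linarith [hu0 x])
  · filter_upwards [hv] with x hx
    exact div_le_div_of_nonneg_left (hu0 x) hc (by linarith [hu0 x])

theorem stmt_2 (ρ ψ : ℝ → ℝ) (hρ : LossClass ρ) (hψ : IsLeftDeriv ρ ψ)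
    (P : Measure ℝ) [IsProbabilityMeasure P]
    (hP1 : ∀ θ : ℝ, P {θ} < 1)
    (hP2 : ∀ θ : ℝ, Integrable (fun z => |ψ (z - θ)|) P) :
    Monotone (Gfun ψ P) ∧
    (∀ θ : ℝ, ContinuousWithinAt (Gfun ψ P) (Set.Ici θ) θ) ∧
    Tendsto (Gfun ψ P) atBot (nhds 0) ∧
    Tendsto (Gfun ψ P) atTop (nhds 1) := by
  have hG : Gfun ψ P = fun θ => (∫ z, (ψ (z - θ))⁻ ∂P) /
      (∫ z, (ψ (z - θ))⁻ ∂P + ∫ z, (ψ (z - θ))⁺ ∂P) := funext fun θ => hψ.gfun_eq hρ (hP2 θ)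
  have hD : ∀ θ, 0 < ∫ z, (ψ (z - θ))⁻ ∂P + ∫ z, (ψ (z - θ))⁺ ∂P := fun θ => by
    rw [← hψ.integral_abs_eq hρ.1 (hP2 θ)]
    exact hψ.integral_abs_pos hρ (hP1 θ) (hP2 θ)
  have hN0 : ∀ θ, 0 ≤ ∫ z, (ψ (z - θ))⁻ ∂P := fun θ => integral_nonneg fun z => negPart_nonneg _
  have hR0 : ∀ θ, 0 ≤ ∫ z, (ψ (z - θ))⁺ ∂P := fun θ => integral_nonneg fun z => posPart_nonneg _
  have hNmono := hψ.monotone_integral_negPart hρ.1 hP2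
  have hRanti := hψ.antitone_integral_posPart hρ.1 hP2
  rw [hG]
  refine ⟨fun a b hab => ?_, fun θ => ?_, ?_, ?_⟩
  · dsimp only
    rw [div_le_div_iff₀ (hD a) (hD b)]
    linarith [mul_le_mul (hNmono hab) (hRanti hab) (hR0 b) (hN0 b)]
  · have hN := hψ.continuousWithinAt_integral_comp continuous_negPart
      abs_negPart_le_abs hρ.1 hP2 θ
    have hR := hψ.continuousWithinAt_integral_comp continuous_posPart
      abs_posPart_le_abs hρ.1 hP2 θ
    exact hN.div (hN.add hR) (hD θ).ne'
  · obtain ⟨θ₀, h₀⟩ := hψ.exists_integral_posPart_pos hρ hP2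
    refine tendsto_div_add_zero h₀ hN0 (hψ.tendsto_integral_negPart_atBot hρ hP2) ?_
    filter_upwards [eventually_le_atBot θ₀] with θ hθ
    exact hRanti hθ
  · obtain ⟨θ₀, h₀⟩ := hψ.exists_integral_negPart_pos hρ hP2
    have h := tendsto_div_add_zero h₀ hR0 (hψ.tendsto_integral_posPart_atTop hρ hP2)
      ((eventually_ge_atTop θ₀).mono fun θ hθ => hNmono hθ)
    have h1 := h.const_sub 1
    rw [sub_zero] at h1
    refine h1.congr fun θ => ?_
    have := hD θ
    rw [add_comm (∫ z, (ψ (z - θ))⁺ ∂P), sub_eq_iff_eq_add, ← add_div, div_self this.ne']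
end
end

section
/- Let ρ(t) = t² and let X and Y be random d-vectors (defined on a common probability space) whose laws belong to 𝒫^ρ_d. Then: (i) (monotonicity) if X ≤ Y almost surely in the componentwise sense, then for every α ∈ (0,1) and every u ∈ S^{d−1} with all coordinates nonnegative, H^ρ_{α,u}(Y) ⊆ H^ρ_{α,u}(X) ⊕ ℝ^d_+ and H^ρ_{α,u}(X) ⊆ H^ρ_{α,u}(Y) ⊕ ℝ^d_−, where ⊕ is the Minkowski sum and ℝ^d_± = {x ∈ ℝ^d : ±x_j ≥ 0 for all j}; (ii) (nestedness) for every u ∈ S^{d−1}, the map α ↦ H^ρ_{α,u}(X) is non-increasing with respect to inclusion, i.e. α ≤ α′ implies H^ρ_{α′,u}(X) ⊆ H^ρ_{α,u}(X). -/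
open MeasureTheory Set Filter
open scoped RealInnerProductSpace Pointwise

noncomputable section

/-- For the quadratic loss `ρ(t) = t²`:
`G_Q(θ) = E_Q[|Y−θ|·𝟙[Y ≤ θ]] / E_Q[|Y−θ|]`. -/
def Gexp (Q : Measure ℝ) (θ : ℝ) : ℝ :=
  (∫ y, |y - θ| * (if y ≤ θ then 1 else 0) ∂Q) / ∫ y, |y - θ| ∂Q

/-- The univariate order-`α` expectile `θ^ρ_α(Q) = inf{θ : G_Q(θ) ≥ α}`. -/
def expectileQ (Q : Measure ℝ) (α : ℝ) : ℝ :=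
  sInf {θ : ℝ | α ≤ Gexp Q θ}

/-- The order-`α` expectile halfspace of a random vector `X` in direction `u`:
`H^ρ_{α,u}(X) = {z : u'z ≥ θ^ρ_α(law of u'X)}`. -/
def expHalf {d : ℕ} {Ω : Type*} [MeasurableSpace Ω] (μ : Measure Ω)
    (X : Ω → EuclideanSpace ℝ (Fin d)) (α : ℝ) (u : EuclideanSpace ℝ (Fin d)) :
    Set (EuclideanSpace ℝ (Fin d)) :=
  {z | expectileQ (μ.map fun ω => ⟪u, X ω⟫) α ≤ ⟪u, z⟫}

/-- The weighted deviation `(θ - y)⁺ - α |y - θ|`, whose expectation has the sign of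
`Gexp Q θ - α`. -/
def expectileScore (α θ y : ℝ) : ℝ := max (θ - y) 0 - α * |y - θ|

lemma expectileScore_antitone {α : ℝ} (h0 : 0 ≤ α) (h1 : α ≤ 1) (θ : ℝ) :
    Antitone (expectileScore α θ) := by
  intro x y hxy
  unfold expectileScore
  rcases le_total θ x with hx | hx <;> rcases le_total θ y with hy | hy
  · rw [max_eq_right (by linarith), max_eq_right (by linarith), abs_of_nonneg (by linarith),
      abs_of_nonneg (by linarith)]
    nlinarith
  · rw [max_eq_right (by linarith : θ - x ≤ 0), max_eq_left (by linarith),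
      abs_of_nonneg (by linarith : 0 ≤ x - θ), abs_of_nonpos (by linarith)]
    nlinarith
  · rw [max_eq_left (by linarith : 0 ≤ θ - x), max_eq_right (by linarith),
      abs_of_nonneg (by linarith : 0 ≤ y - θ), abs_of_nonpos (by linarith)]
    nlinarith
  · rw [max_eq_left (by linarith), max_eq_left (by linarith), abs_of_nonpos (by linarith),
      abs_of_nonpos (by linarith)]
    nlinarith

lemma expectileScore_le {α : ℝ} (h0 : 0 ≤ α) (h1 : α ≤ 1) {θ : ℝ} (hθ : θ ≤ 0) (y : ℝ) :
    expectileScore α θ y ≤ |y| + α * θ := by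
  unfold expectileScore
  rcases le_total θ y with hy | hy
  · rw [max_eq_right (by linarith), abs_of_nonneg (by linarith)]
    nlinarith [neg_abs_le y, abs_nonneg y]
  · rw [max_eq_left (by linarith), abs_of_nonpos (by linarith), abs_of_nonpos (by linarith)]
    nlinarith

lemma le_expectileScore {α : ℝ} (h0 : 0 ≤ α) (h1 : α ≤ 1) {θ : ℝ} (hθ : 0 ≤ θ) (y : ℝ) :
    (1 - α) * θ - |y| ≤ expectileScore α θ y := by
  unfold expectileScore
  rcases le_total θ y with hy | hy
  · rw [max_eq_right (by linarith), abs_of_nonneg (by linarith), abs_of_nonneg (by linarith)]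
    nlinarith
  · rw [max_eq_left (by linarith), abs_of_nonpos (by linarith : y - θ ≤ 0)]
    nlinarith [le_abs_self y, abs_nonneg y]

section Expectile

variable {Ω : Type*} [MeasurableSpace Ω] {μ : Measure Ω} [IsProbabilityMeasure μ] {g : Ω → ℝ}

lemma integrable_expectileScore (hg : Integrable g μ) (α θ : ℝ) :
    Integrable (fun ω => expectileScore α θ (g ω)) μ :=
  (((integrable_const θ).sub hg).pos_part).sub ((hg.sub (integrable_const θ)).abs.const_mul α)

lemma integral_abs_sub_const_pos (hg : Integrable g μ) {θ : ℝ} (hne : μ {ω | g ω = θ} < 1) :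
    0 < ∫ ω, |g ω - θ| ∂μ := by
  refine (integral_nonneg fun ω => abs_nonneg _).lt_of_ne' fun h => hne.ne ?_
  replace h := (integral_eq_zero_iff_of_nonneg (fun ω => abs_nonneg (g ω - θ))
    (hg.sub (integrable_const θ)).abs).1 h
  refine le_antisymm prob_le_one (measure_univ.symm.trans_le (measure_mono_ae ?_))
  filter_upwards [h] with ω hω _
  exact sub_eq_zero.1 (abs_eq_zero.1 hω)

lemma le_Gexp_map_iff (hm : Measurable g) (hg : Integrable g μ) {θ : ℝ}
    (hne : μ {ω | g ω = θ} < 1) (α : ℝ) :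
    α ≤ Gexp (μ.map g) θ ↔ 0 ≤ ∫ ω, expectileScore α θ (g ω) ∂μ := by
  have hden : ∫ y, |y - θ| ∂(μ.map g) = ∫ ω, |g ω - θ| ∂μ :=
    integral_map hm.aemeasurable (by fun_prop)
  have hnum : ∫ y, |y - θ| * (if y ≤ θ then 1 else 0) ∂(μ.map g)
      = ∫ ω, max (θ - g ω) 0 ∂μ := by
    have hpos : (fun y : ℝ => |y - θ| * (if y ≤ θ then 1 else 0)) = fun y => max (θ - y) 0 := by
      funext y
      split_ifs with h
      · rw [mul_one, abs_of_nonpos (by linarith), max_eq_left (by linarith), neg_sub]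
      · rw [mul_zero, max_eq_right (by linarith)]
    rw [hpos]
    exact integral_map hm.aemeasurable (by fun_prop)
  have hsplit : ∫ ω, expectileScore α θ (g ω) ∂μ
      = ∫ ω, max (θ - g ω) 0 ∂μ - α * ∫ ω, |g ω - θ| ∂μ := by
    rw [← integral_const_mul]
    exact integral_sub ((integrable_const θ).sub hg).pos_part
      ((hg.sub (integrable_const θ)).abs.const_mul α)
  rw [Gexp, hnum, hden, hsplit, le_div_iff₀ (integral_abs_sub_const_pos hg hne), sub_nonneg]

lemma bddBelow_le_Gexp_map (hm : Measurable g) (hg : Integrable g μ)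
    (hne : ∀ c, μ {ω | g ω = c} < 1) {α : ℝ} (h0 : 0 < α) (h1 : α ≤ 1) :
    BddBelow {θ | α ≤ Gexp (μ.map g) θ} := by
  have hM : 0 ≤ ∫ ω, |g ω| ∂μ := integral_nonneg fun ω => abs_nonneg _
  refine ⟨-(∫ ω, |g ω| ∂μ) / α, fun θ hθ => ?_⟩
  rw [mem_ofPred_eq, le_Gexp_map_iff hm hg (hne θ)] at hθ
  rw [div_le_iff₀ h0]
  rcases le_total 0 θ with h | h
  · nlinarith
  have hle : ∫ ω, expectileScore α θ (g ω) ∂μ ≤ ∫ ω, (|g ω| + α * θ) ∂μ :=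
    integral_mono (integrable_expectileScore hg α θ) (hg.abs.add (integrable_const _))
      fun ω => expectileScore_le h0.le h1 h (g ω)
  rw [integral_add hg.abs (integrable_const _), integral_const, probReal_univ, one_smul] at hle
  linarith

lemma nonempty_le_Gexp_map (hm : Measurable g) (hg : Integrable g μ)
    (hne : ∀ c, μ {ω | g ω = c} < 1) {α : ℝ} (h0 : 0 ≤ α) (h1 : α < 1) :
    {θ | α ≤ Gexp (μ.map g) θ}.Nonempty := by
  have hM : 0 ≤ ∫ ω, |g ω| ∂μ := integral_nonneg fun ω => abs_nonneg _
  have h1' : 0 < 1 - α := sub_pos.2 h1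
  set θ := (∫ ω, |g ω| ∂μ) / (1 - α) with hθ
  refine ⟨θ, ?_⟩
  rw [mem_ofPred_eq, le_Gexp_map_iff hm hg (hne θ)]
  have hle : ∫ ω, ((1 - α) * θ - |g ω|) ∂μ ≤ ∫ ω, expectileScore α θ (g ω) ∂μ :=
    integral_mono ((integrable_const _).sub hg.abs) (integrable_expectileScore hg α θ)
      fun ω => le_expectileScore h0 h1.le (div_nonneg hM h1'.le) (g ω)
  rw [integral_sub (integrable_const _) hg.abs, integral_const, probReal_univ, one_smul, hθ,
    mul_div_cancel₀ _ h1'.ne', sub_self] at hle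
  exact hle

lemma expectileQ_map_mono {f : Ω → ℝ} (hfm : Measurable f) (hgm : Measurable g)
    (hf : Integrable f μ) (hg : Integrable g μ) (hfne : ∀ c, μ {ω | f ω = c} < 1)
    (hgne : ∀ c, μ {ω | g ω = c} < 1) (hfg : f ≤ᵐ[μ] g) {α : ℝ} (h0 : 0 < α) (h1 : α < 1) :
    expectileQ (μ.map f) α ≤ expectileQ (μ.map g) α := by
  refine csInf_le_csInf (bddBelow_le_Gexp_map hfm hf hfne h0 h1.le)
    (nonempty_le_Gexp_map hgm hg hgne h0.le h1) fun θ hθ => ?_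
  rw [mem_ofPred_eq, le_Gexp_map_iff hgm hg (hgne θ)] at hθ
  rw [mem_ofPred_eq, le_Gexp_map_iff hfm hf (hfne θ)]
  refine hθ.trans (integral_mono_ae (integrable_expectileScore hg α θ)
    (integrable_expectileScore hf α θ) ?_)
  filter_upwards [hfg] with ω hω
  exact expectileScore_antitone h0.le h1.le θ hω

lemma expectileQ_map_mono_order (hm : Measurable g) (hg : Integrable g μ)
    (hne : ∀ c, μ {ω | g ω = c} < 1) {α β : ℝ} (h0 : 0 < α) (hαβ : α ≤ β) (h1 : β < 1) :
    expectileQ (μ.map g) α ≤ expectileQ (μ.map g) β :=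
  csInf_le_csInf (bddBelow_le_Gexp_map hm hg hne h0 (hαβ.trans h1.le))
    (nonempty_le_Gexp_map hm hg hne (h0.le.trans hαβ) h1) fun _ hθ => hαβ.trans hθ

end Expectile

theorem stmt_18 {d : ℕ} (hd : 0 < d) {Ω : Type*} [MeasurableSpace Ω]
    (μ : Measure Ω) [IsProbabilityMeasure μ]
    (X Y : Ω → EuclideanSpace ℝ (Fin d))
    (hXmeas : Measurable X) (hYmeas : Measurable Y)
    (hXmom : Integrable X μ) (hYmom : Integrable Y μ)
    (hXhyp : ∀ u : EuclideanSpace ℝ (Fin d), ‖u‖ = 1 → ∀ c : ℝ,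
      μ {ω | ⟪u, X ω⟫ = c} < 1)
    (hYhyp : ∀ u : EuclideanSpace ℝ (Fin d), ‖u‖ = 1 → ∀ c : ℝ,
      μ {ω | ⟪u, Y ω⟫ = c} < 1) :
    ((∀ᵐ ω ∂μ, ∀ i : Fin d, X ω i ≤ Y ω i) →
      ∀ α : ℝ, α ∈ Set.Ioo (0 : ℝ) 1 →
        ∀ u : EuclideanSpace ℝ (Fin d), ‖u‖ = 1 → (∀ i : Fin d, 0 ≤ u i) →
          expHalf μ Y α u ⊆
            expHalf μ X α u + {x : EuclideanSpace ℝ (Fin d) | ∀ i : Fin d, 0 ≤ x i} ∧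
          expHalf μ X α u ⊆
            expHalf μ Y α u + {x : EuclideanSpace ℝ (Fin d) | ∀ i : Fin d, x i ≤ 0}) ∧
    (∀ u : EuclideanSpace ℝ (Fin d), ‖u‖ = 1 →
      ∀ α α' : ℝ, 0 < α → α ≤ α' → α' < 1 →
        expHalf μ X α' u ⊆ expHalf μ X α u) := by
  have hm {Z : Ω → EuclideanSpace ℝ (Fin d)} (hZ : Measurable Z) (u) :
      Measurable fun ω => ⟪u, Z ω⟫ := hZ.const_inner
  have hi {Z : Ω → EuclideanSpace ℝ (Fin d)} (hZ : Integrable Z μ) (u) :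
      Integrable (fun ω => ⟪u, Z ω⟫) μ := hZ.const_inner u
  refine ⟨fun hXY α hα u hu hu0 => ?_, fun u hu α α' h0 hαα' h1 z hz =>
    (expectileQ_map_mono_order (hm hXmeas u) (hi hXmom u) (hXhyp u hu) h0 hαα' h1).trans hz⟩
  have hle : expectileQ (μ.map fun ω => ⟪u, X ω⟫) α ≤ expectileQ (μ.map fun ω => ⟪u, Y ω⟫) α := by
    refine expectileQ_map_mono (hm hXmeas u) (hm hYmeas u) (hi hXmom u) (hi hYmom u)
      (hXhyp u hu) (hYhyp u hu) ?_ hα.1 hα.2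
    filter_upwards [hXY] with ω hω
    simp only [PiLp.inner_apply, RCLike.inner_apply, conj_trivial]
    exact Finset.sum_le_sum fun i _ => mul_le_mul_of_nonneg_right (hω i) (hu0 i)
  refine ⟨fun z hz => ⟨z, hle.trans hz, 0, fun i => le_rfl, add_zero z⟩, fun z hz => ?_⟩
  set t := expectileQ (μ.map fun ω => ⟪u, Y ω⟫) α - expectileQ (μ.map fun ω => ⟪u, X ω⟫) α with ht
  have ht0 : 0 ≤ t := sub_nonneg.2 hle
  refine ⟨z + t • u, ?_, -(t • u), fun i => ?_, add_neg_cancel_right z _⟩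
  · have hz' : expectileQ (μ.map fun ω => ⟪u, X ω⟫) α ≤ ⟪u, z⟫ := hz
    change expectileQ (μ.map fun ω => ⟪u, Y ω⟫) α ≤ ⟪u, z + t • u⟫
    rw [inner_add_right, real_inner_smul_right, real_inner_self_eq_norm_sq, hu]
    linarith
  · simpa using mul_nonneg ht0 (hu0 i)
end
end
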